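/- Penalized-MDP lower bound on the true return: Let M = (S, A, T, r, μ₀, γ) and M̃ = (S, A, T̃, r, μ₀, γ) be two finite discounted MDPs differing only in their dynamics, and let ũ : S × A → ℝ be an admissible error estimator, i.e. for every stationary stochastic policy π and every (s, a) ∈ S × A, |E_{s'∼T̃(s,a)}[V_M^π(s')] − E_{s'∼T(s,a)}[V_M^π(s')]| ≤ ũ(s, a). Set λ := γ and define the penalized reward r̃(s, a) := r(s, a) − λ·ũ(s, a) and the penalized model MDP M̃_r̃ := (S, A, T̃, r̃, μ₀, γ). Then for every stationary stochastic policy π, η_M(π) ≥ η_{M̃_r̃}(π). -/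

import Mathlib

open scoped BigOperators

/-- Expectation of a real-valued function under a `PMF` on a finite type. -/
noncomputable def pmfExp {X : Type*} [Fintype X] (d : PMF X) (f : X → ℝ) : ℝ :=
  ∑ x, (d x).toReal * f x

/-- Initial state–action distribution: `s ∼ μ`, `a ∼ π s`. -/
noncomputable def initSA {S A : Type*} (π : S → PMF A) (μ : PMF S) : PMF (S × A) :=
  μ.bind fun s => (π s).map fun a => (s, a)

/-- One step of the state–action Markov chain induced by dynamics `T` and policy `π`. -/
noncomputable def stepSA {S A : Type*} (T : S → A → PMF S) (π : S → PMF A)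
    (d : PMF (S × A)) : PMF (S × A) :=
  d.bind fun sa => (T sa.1 sa.2).bind fun s' => (π s').map fun a' => (s', a')

/-- Distribution of the time-`t` state–action pair of the chain started from `μ`. -/
noncomputable def saDist {S A : Type*} (T : S → A → PMF S) (π : S → PMF A)
    (μ : PMF S) : ℕ → PMF (S × A)
  | 0 => initSA π μ
  | (t + 1) => stepSA T π (saDist T π μ t)

/-- Unnormalized discounted occupancy expectation
`Ē_{(s,a)∼ρ_T^π}[f] = Σ_t γ^t E[f(s_t,a_t)]`, chain started from `μ`. -/
noncomputable def occExp {S A : Type*} [Fintype S] [Fintype A]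
    (T : S → A → PMF S) (π : S → PMF A) (μ : PMF S) (γ : ℝ) (f : S × A → ℝ) : ℝ :=
  ∑' t : ℕ, γ ^ t * pmfExp (saDist T π μ t) f

/-- Value function `V_M^π(s)` of the MDP with dynamics `T`, reward `r`, discount `γ`. -/
noncomputable def valueFun {S A : Type*} [Fintype S] [Fintype A]
    (T : S → A → PMF S) (π : S → PMF A) (r : S × A → ℝ) (γ : ℝ) (s : S) : ℝ :=
  occExp T π (PMF.pure s) γ r

/-- Expected return `η_M(π) = E_{s∼μ₀}[V_M^π(s)]`. -/
noncomputable def expReturn {S A : Type*} [Fintype S] [Fintype A]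
    (T : S → A → PMF S) (π : S → PMF A) (r : S × A → ℝ) (γ : ℝ) (μ : PMF S) : ℝ :=
  ∑ s, (μ s).toReal * valueFun T π r γ s

/-- Model-error gap `G_{M̃}^π(s,a) = E_{s'∼T̃(s,a)}[V_M^π(s')] − E_{s'∼T(s,a)}[V_M^π(s')]`,
where `T` is the true dynamics and `T'` the model dynamics. -/
noncomputable def Ggap {S A : Type*} [Fintype S] [Fintype A]
    (T T' : S → A → PMF S) (π : S → PMF A) (r : S × A → ℝ) (γ : ℝ) (sa : S × A) : ℝ :=
  (∑ s', ((T' sa.1 sa.2) s').toReal * valueFun T π r γ s') -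
    (∑ s', ((T sa.1 sa.2) s').toReal * valueFun T π r γ s')

theorem pmfExp_mono {X : Type*} [Fintype X] (d : PMF X) {f g : X → ℝ} (h : ∀ x, f x ≤ g x) :
    pmfExp d f ≤ pmfExp d g :=
  Finset.sum_le_sum fun x _ => mul_le_mul_of_nonneg_left (h x) ENNReal.toReal_nonneg

theorem pmfExp_add {X : Type*} [Fintype X] (d : PMF X) (f g : X → ℝ) :
    pmfExp d (fun x => f x + g x) = pmfExp d f + pmfExp d g := by
  simp only [pmfExp, mul_add, Finset.sum_add_distrib]

theorem pmfExp_sub {X : Type*} [Fintype X] (d : PMF X) (f g : X → ℝ) :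
    pmfExp d (fun x => f x - g x) = pmfExp d f - pmfExp d g := by
  simp only [pmfExp, mul_sub, Finset.sum_sub_distrib]

theorem pmfExp_const_mul {X : Type*} [Fintype X] (d : PMF X) (c : ℝ) (f : X → ℝ) :
    pmfExp d (fun x => c * f x) = c * pmfExp d f := by
  simp only [pmfExp, Finset.mul_sum, mul_left_comm]

theorem abs_pmfExp_le {X : Type*} [Fintype X] (d : PMF X) (f : X → ℝ) :
    |pmfExp d f| ≤ ∑ x, |f x| := by
  refine (Finset.abs_sum_le_sum_abs _ _).trans (Finset.sum_le_sum fun x _ => ?_)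
  rw [abs_mul, abs_of_nonneg ENNReal.toReal_nonneg]
  refine mul_le_of_le_one_left (abs_nonneg _) ?_
  exact ENNReal.toReal_le_of_le_ofReal zero_le_one (by simpa using d.coe_le_one x)

theorem pmfExp_pure {X : Type*} [Fintype X] (x : X) (f : X → ℝ) :
    pmfExp (PMF.pure x) f = f x := by
  classical
  simp [pmfExp, PMF.pure_apply, apply_ite ENNReal.toReal, ite_mul]

theorem pmfExp_bind {X Y : Type*} [Fintype X] [Fintype Y] (d : PMF X) (k : X → PMF Y)
    (f : Y → ℝ) : pmfExp (d.bind k) f = pmfExp d fun x => pmfExp (k x) f := by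
  have h (y : Y) : ((d.bind k) y).toReal = ∑ x, (d x).toReal * (k x y).toReal := by
    rw [PMF.bind_apply, tsum_fintype, ENNReal.toReal_sum fun x _ =>
      ENNReal.mul_ne_top (d.apply_ne_top x) ((k x).apply_ne_top y)]
    simp only [ENNReal.toReal_mul]
  simp only [pmfExp, h, Finset.sum_mul, Finset.mul_sum]
  rw [Finset.sum_comm]
  simp only [mul_assoc]

theorem pmfExp_map {X Y : Type*} [Fintype X] [Fintype Y] (d : PMF X) (g : X → Y)
    (f : Y → ℝ) : pmfExp (d.map g) f = pmfExp d fun x => f (g x) := by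
  simp only [PMF.map, pmfExp_bind, Function.comp_apply, pmfExp_pure]

theorem hasSum_pmfExp {X : Type*} [Fintype X] (d : PMF X) {f : ℕ → X → ℝ} {F : X → ℝ}
    (h : ∀ x, HasSum (fun t => f t x) (F x)) :
    HasSum (fun t => pmfExp d (f t)) (pmfExp d F) :=
  hasSum_sum fun x _ => (h x).mul_left _

theorem summable_discounted_pmfExp {X : Type*} [Fintype X] {γ : ℝ} (hγ0 : 0 ≤ γ) (hγ1 : γ < 1)
    (d : ℕ → PMF X) (f : X → ℝ) : Summable fun t => γ ^ t * pmfExp (d t) f := by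
  refine Summable.of_norm_bounded
    ((summable_geometric_of_lt_one hγ0 hγ1).mul_right (∑ x, |f x|)) fun t => ?_
  rw [Real.norm_eq_abs, abs_mul, abs_of_nonneg (pow_nonneg hγ0 t)]
  exact mul_le_mul_of_nonneg_left (abs_pmfExp_le _ _) (pow_nonneg hγ0 t)

theorem pmfExp_initSA_pure {S A : Type*} [Fintype S] [Fintype A] (π : S → PMF A) (s : S)
    (f : S × A → ℝ) : pmfExp (initSA π (PMF.pure s)) f = pmfExp (π s) fun a => f (s, a) := by
  simp only [initSA, PMF.pure_bind, pmfExp_map]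

theorem pmfExp_stepSA {S A : Type*} [Fintype S] [Fintype A] (T : S → A → PMF S)
    (π : S → PMF A) (d : PMF (S × A)) (f : S × A → ℝ) :
    pmfExp (stepSA T π d) f =
      pmfExp d fun sa => pmfExp (T sa.1 sa.2) fun s' => pmfExp (π s') fun a' => f (s', a') := by
  simp only [stepSA, pmfExp_bind, pmfExp_map]

/-- Conditioning on the first action and transition instead of the last ones. -/
theorem saDist_pure_succ {S A : Type*} (T : S → A → PMF S) (π : S → PMF A) (s : S) (t : ℕ) :
    saDist T π (PMF.pure s) (t + 1) =
      (π s).bind fun a => (T s a).bind fun s' => saDist T π (PMF.pure s') t := by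
  induction t with
  | zero => simp [saDist, stepSA, initSA, PMF.bind_map, Function.comp_def]
  | succ t ih =>
    rw [saDist, ih]
    simp only [saDist, stepSA, PMF.bind_bind]

theorem hasSum_valueFun {S A : Type*} [Fintype S] [Fintype A] (T : S → A → PMF S)
    (π : S → PMF A) (r : S × A → ℝ) {γ : ℝ} (hγ0 : 0 ≤ γ) (hγ1 : γ < 1) (s : S) :
    HasSum (fun t => γ ^ t * pmfExp (saDist T π (PMF.pure s) t) r) (valueFun T π r γ s) :=
  (summable_discounted_pmfExp hγ0 hγ1 _ r).hasSum

/-- The Bellman equation. -/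
theorem valueFun_eq_bellman {S A : Type*} [Fintype S] [Fintype A] (T : S → A → PMF S)
    (π : S → PMF A) (r : S × A → ℝ) {γ : ℝ} (hγ0 : 0 ≤ γ) (hγ1 : γ < 1) (s : S) :
    valueFun T π r γ s =
      pmfExp (π s) fun a => r (s, a) + γ * pmfExp (T s a) (valueFun T π r γ) := by
  have hstep : HasSum (fun t => γ ^ (t + 1) * pmfExp (saDist T π (PMF.pure s) (t + 1)) r)
      (γ * pmfExp (π s) fun a => pmfExp (T s a) (valueFun T π r γ)) := by
    have hterm (t : ℕ) : γ ^ (t + 1) * pmfExp (saDist T π (PMF.pure s) (t + 1)) r =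
        γ * pmfExp (π s) fun a => pmfExp (T s a) fun s' =>
          γ ^ t * pmfExp (saDist T π (PMF.pure s') t) r := by
      simp only [saDist_pure_succ, pmfExp_bind, pmfExp_const_mul]
      ring
    simp only [hterm]
    exact (hasSum_pmfExp (π s) fun a => hasSum_pmfExp (T s a)
      (hasSum_valueFun T π r hγ0 hγ1)).mul_left γ
  have h := (hasSum_valueFun T π r hγ0 hγ1 s).tsum_eq
  rw [(hasSum_valueFun T π r hγ0 hγ1 s).summable.tsum_eq_zero_add, hstep.tsum_eq] at h
  rw [← h, pmfExp_add, pmfExp_const_mul]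
  simp [saDist, pmfExp_initSA_pure]

/-- If `f` is at most the Bellman residual of `Q` under `T` and `π`, then the value of the reward
`f` is at most the `π`-average of `Q`. -/
theorem valueFun_le_of_le_bellman_residual {S A : Type*} [Fintype S] [Fintype A]
    (T : S → A → PMF S) (π : S → PMF A) {γ : ℝ} (hγ0 : 0 ≤ γ) (hγ1 : γ < 1) (f Q : S × A → ℝ)
    (h : ∀ sa, f sa ≤
      Q sa - γ * pmfExp (T sa.1 sa.2) fun s' => pmfExp (π s') fun a' => Q (s', a')) (s : S) :
    valueFun T π f γ s ≤ pmfExp (π s) fun a => Q (s, a) := by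
  have hQ := summable_discounted_pmfExp hγ0 hγ1 (saDist T π (PMF.pure s)) Q
  have hQ' := (summable_nat_add_iff 1).2 hQ
  have hle := hasSum_le (fun t => ?_) (hasSum_valueFun T π f hγ0 hγ1 s)
    (hQ.hasSum.sub hQ'.hasSum)
  · rw [hQ.tsum_eq_zero_add, add_sub_cancel_right] at hle
    simpa [saDist, pmfExp_initSA_pure] using hle
  · calc γ ^ t * pmfExp (saDist T π (PMF.pure s) t) f
        ≤ γ ^ t * pmfExp (saDist T π (PMF.pure s) t) (fun sa => Q sa -
            γ * pmfExp (T sa.1 sa.2) fun s' => pmfExp (π s') fun a' => Q (s', a')) :=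
          mul_le_mul_of_nonneg_left (pmfExp_mono _ h) (pow_nonneg hγ0 t)
      _ = _ := by
          rw [pmfExp_sub, pmfExp_const_mul, saDist, pmfExp_stepSA]
          ring

/-- **Penalized-MDP lower bound on the true return.**
If `ũ` is an admissible error estimator (for every policy `π` and every `(s,a)`,
`|E_{s'∼T̃(s,a)}[V_M^π(s')] − E_{s'∼T(s,a)}[V_M^π(s')]| ≤ ũ(s,a)`), then with `λ := γ`
and penalized reward `r̃(s,a) = r(s,a) − λ·ũ(s,a)`, for every policy `π`,
`η_M(π) ≥ η_{M̃_r̃}(π)`. -/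
theorem penalized_mdp_lower_bound
    {S A : Type*} [Fintype S] [Fintype A] [Nonempty S] [Nonempty A]
    (T T' : S → A → PMF S) (r : S × A → ℝ) (μ₀ : PMF S) (γ : ℝ)
    (hγ0 : 0 ≤ γ) (hγ1 : γ < 1) (u : S × A → ℝ)
    (hu : ∀ (π : S → PMF A) (s : S) (a : A),
      |(∑ s', ((T' s a) s').toReal * valueFun T π r γ s') -
        (∑ s', ((T s a) s').toReal * valueFun T π r γ s')| ≤ u (s, a)) :
    ∀ π : S → PMF A,
      expReturn T π r γ μ₀ ≥
        expReturn T' π (fun sa => r sa - γ * u sa) γ μ₀ := by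
  intro π
  refine pmfExp_mono μ₀ fun s => ?_
  rw [valueFun_eq_bellman T π r hγ0 hγ1 s]
  refine valueFun_le_of_le_bellman_residual T' π hγ0 hγ1 _
    (fun sa => r sa + γ * pmfExp (T sa.1 sa.2) (valueFun T π r γ)) (fun sa => ?_) s
  simp only [← valueFun_eq_bellman T π r hγ0 hγ1]
  have hgap : pmfExp (T' sa.1 sa.2) (valueFun T π r γ) -
      pmfExp (T sa.1 sa.2) (valueFun T π r γ) ≤ u sa :=
    (le_abs_self _).trans (hu π sa.1 sa.2)
  linarith [mul_le_mul_of_nonneg_left hgap hγ0]
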